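/- Let m' ∈ ℕ, μ ∈ ℕ with 1 ≤ μ ≤ 2^{m'}, θ ∈ (0, π/2] defined by sin²θ = 2^{-m'}μ, and L ∈ ℕ with L ≥ M^{p/2}/6 (where M ≥ ⌈6^{2/p}⌉, p ≥ 1) and (2L+1)θ ≤ π/2. Then μ^{-1} sin²((2L+1)θ) ≥ (4/(9π²)) M^p 2^{-m'}. -/

import Mathlib

open Real

theorem stmt_7 (m' μ : ℕ) (hμ1 : 1 ≤ μ) (hμ2 : μ ≤ 2 ^ m')
    (θ : ℝ) (hθ0 : 0 < θ) (hθ1 : θ ≤ π / 2)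
    (hθ : Real.sin θ ^ 2 = (2 : ℝ) ^ (-(m' : ℝ)) * μ)
    (M p : ℝ) (hp : 1 ≤ p) (hM : (⌈(6 : ℝ) ^ (2 / p)⌉ : ℝ) ≤ M)
    (L : ℕ) (hL : M ^ (p / 2) / 6 ≤ (L : ℝ))
    (hLθ : (2 * (L : ℝ) + 1) * θ ≤ π / 2) :
    (4 / (9 * π ^ 2)) * M ^ p * (2 : ℝ) ^ (-(m' : ℝ)) ≤
      (μ : ℝ)⁻¹ * Real.sin ((2 * (L : ℝ) + 1) * θ) ^ 2 := by
  have hM0 : 0 < M :=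
    lt_of_lt_of_le (by exact_mod_cast Int.ceil_pos.mpr (by positivity)) hM
  have hMp : M ^ p = (M ^ (p / 2)) ^ 2 := by
    rw [sq, ← Real.rpow_add hM0, add_halves]
  have hμ0 : (0 : ℝ) < μ := by exact_mod_cast hμ1
  have hA : 0 < M ^ (p / 2) := Real.rpow_pos_of_pos hM0 _
  have hsin0 : 0 ≤ Real.sin θ := Real.sin_nonneg_of_nonneg_of_le_pi hθ0.le (by linarith)
  have hsin : 2 / π * (M ^ (p / 2) / 3 * Real.sin θ) ≤ Real.sin ((2 * (L : ℝ) + 1) * θ) := calc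
    _ ≤ 2 / π * ((2 * (L : ℝ) + 1) * θ) := by
      gcongr
      · linarith
      · exact Real.sin_le hθ0.le
    _ ≤ _ := Real.mul_le_sin (by positivity) hLθ
  calc
    _ = (μ : ℝ)⁻¹ * (2 / π * (M ^ (p / 2) / 3 * Real.sin θ)) ^ 2 := by
      rw [mul_pow, mul_pow, hθ, hMp]
      field_simp
      norm_num
    _ ≤ _ := by gcongr
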